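/- Let W be a standard Brownian motion on a probability space (Ω, F, P). For every real T with 0 ≤ T < π/(2√2), the random variable ω ↦ exp(∫_0^T W_t(ω)² dt) is integrable and E[exp(∫_0^T W_t² dt)] = 1/√(cos(√2 · T)). -/

import Mathlib

open MeasureTheory ProbabilityTheory Real

/-- A standard Brownian motion: a jointly measurable real process with a.s. continuous
paths on `[0, ∞)`, starting at `0`, whose finite-dimensional distributions are centered
Gaussian with covariance `E[W_s W_t] = min s t` (expressed via the Cramér–Wold device:
every finite linear combination `∑ i, c i * W (t i)` is a centered Gaussian random
variable with the corresponding variance `∑ i, ∑ j, c i * c j * min (t i) (t j)`). -/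
structure IsStandardBrownianMotion {Ω : Type*} [MeasureSpace Ω] (W : ℝ → Ω → ℝ) : Prop where
  jointly_measurable : Measurable fun p : ℝ × Ω => W p.1 p.2
  ae_continuous : ∀ᵐ ω : Ω, ContinuousOn (fun t => W t ω) (Set.Ici (0 : ℝ))
  start_at_zero : ∀ᵐ ω : Ω, W 0 ω = 0
  gaussian_fdd : ∀ (k : ℕ) (t : Fin k → ℝ), (∀ i, 0 ≤ t i) → ∀ c : Fin k → ℝ,
    Measure.map (fun ω => ∑ i, c i * W (t i) ω) (ℙ : Measure Ω)
      = gaussianReal 0 (∑ i, ∑ j, c i * c j * min (t i) (t j)).toNNReal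

section

open Filter Topology
open scoped NNReal ENNReal

namespace IsStandardBrownianMotion

variable {Ω : Type*} [MeasureSpace Ω] {W : ℝ → Ω → ℝ}

lemma measurable_eval (hW : IsStandardBrownianMotion W) (t : ℝ) : Measurable (W t) :=
  hW.jointly_measurable.comp measurable_prodMk_left

lemma map_eval (hW : IsStandardBrownianMotion W) (t : ℝ≥0) :
    Measure.map (W t) (ℙ : Measure Ω) = gaussianReal 0 t := by
  simpa using hW.gaussian_fdd 1 (fun _ => t) (by simp) (fun _ => 1)

lemma map_add (hW : IsStandardBrownianMotion W) {s t : ℝ≥0} (hst : s ≤ t) :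
    Measure.map (W s + W t) (ℙ : Measure Ω) = gaussianReal 0 (3 * s + t) := by
  have h := hW.gaussian_fdd 2 ![(s : ℝ), t] (by simp [Fin.forall_fin_two]) (fun _ => 1)
  have hst' : (s : ℝ) ≤ t := hst
  have e : (s : ℝ) + s + (s + t) = ((3 * s + t : ℝ≥0) : ℝ) := by push_cast; ring
  simp only [Fin.sum_univ_two, Matrix.cons_val_zero, Matrix.cons_val_one, one_mul, min_self,
    min_eq_left hst', min_eq_right hst', e, Real.toNNReal_coe] at h
  exact h

lemma isGaussianProcess (hW : IsStandardBrownianMotion W) :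
    IsGaussianProcess (fun t : ℝ≥0 => W t) (ℙ : Measure Ω) where
  hasGaussianLaw I := by
    have hm : Measurable fun ω => I.restrict (fun t : ℝ≥0 => W t ω) :=
      measurable_pi_lambda _ fun t => hW.measurable_eval _
    refine ⟨isGaussian_of_map_eq_gaussianReal fun L => ?_⟩
    let e := Fintype.equivFin I
    refine ⟨0, Real.toNNReal (∑ i, ∑ j, (L fun k => if e.symm i = k then 1 else 0) *
      (L fun k => if e.symm j = k then 1 else 0) *
        min (e.symm i : ℝ≥0) (e.symm j : ℝ≥0)), ?_⟩
    rw [Measure.map_map (by fun_prop) hm]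
    convert hW.gaussian_fdd _ (fun i => ((e.symm i : ℝ≥0) : ℝ)) (by simp)
      (fun i => L fun j => if e.symm i = j then 1 else 0) using 2
    rotate_left
    · simp
    ext ω
    rw [e.symm.sum_comp fun i : I => (L fun j => if i = j then 1 else 0) * W (i : ℝ≥0) ω]
    have h := L.toLinearMap.pi_apply_eq_sum_univ (I.restrict fun t : ℝ≥0 => W t ω)
    simpa [mul_comm] using h

lemma isPreBrownianReal [IsProbabilityMeasure (ℙ : Measure Ω)]
    (hW : IsStandardBrownianMotion W) :
    IsPreBrownianReal (fun t : ℝ≥0 => W t) (ℙ : Measure Ω) := by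
  have hG := hW.isGaussianProcess
  have hlaw (t : ℝ≥0) : HasLaw (W t) (gaussianReal 0 t) (ℙ : Measure Ω) :=
    ⟨(hW.measurable_eval t).aemeasurable, hW.map_eval t⟩
  have hL2 (t : ℝ≥0) : MemLp (W t) 2 (ℙ : Measure Ω) := (hG.hasGaussianLaw_eval t).memLp_two
  refine hG.isPreBrownianReal_of_covariance (fun t => ?_) fun s t hst => ?_
  · rw [(hlaw t).integral_eq, integral_id_gaussianReal]
  · have h := variance_add (hL2 s) (hL2 t)
    have hsum : HasLaw (W s + W t) (gaussianReal 0 (3 * s + t)) (ℙ : Measure Ω) :=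
      ⟨((hW.measurable_eval s).add (hW.measurable_eval t)).aemeasurable, hW.map_add hst⟩
    rw [hsum.variance_eq, (hlaw s).variance_eq, (hlaw t).variance_eq] at h
    simp only [variance_id_gaussianReal] at h
    push_cast at h
    linarith

end IsStandardBrownianMotion

/-- Left Riemann sums of a continuous function on `[0, T]` converge to its integral. -/
lemma tendsto_leftRiemannSum {g : ℝ → ℝ} {T : ℝ} (hT : 0 ≤ T)
    (hg : ContinuousOn g (Set.Icc 0 T)) :
    Tendsto (fun n : ℕ => T / n * ∑ k ∈ Finset.range n, g (k * (T / n))) atTop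
      (𝓝 (∫ t in (0 : ℝ)..T, g t)) := by
  have huc := isCompact_Icc.uniformContinuousOn_of_continuous hg
  rw [Metric.uniformContinuousOn_iff] at huc
  rw [Metric.tendsto_atTop]
  intro ε hε
  obtain ⟨δ, hδ, H⟩ := huc (ε / (T + 1)) (by positivity)
  obtain ⟨N, hN⟩ := exists_nat_gt (T / δ)
  refine ⟨N + 1, fun n hn => ?_⟩
  have hn0 : (0 : ℝ) < n := by exact_mod_cast (by omega : 0 < n)
  have hNn : (N : ℝ) ≤ n := by exact_mod_cast (by omega : N ≤ n)
  set h := T / n with hh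
  have hh0 : 0 ≤ h := by positivity
  have hhδ : h < δ := by
    rw [hh, div_lt_iff₀ hn0]
    rw [div_lt_iff₀ hδ] at hN
    nlinarith
  have hnh : n * h = T := by rw [hh]; field_simp
  have hsub (k : ℕ) (hk : k < n) : Set.Icc (k * h) ((k + 1 : ℕ) * h) ⊆ Set.Icc 0 T := by
    refine Set.Icc_subset_Icc (by positivity) ?_
    rw [← hnh]
    gcongr
    exact hk
  have hle (k : ℕ) : k * h ≤ (k + 1 : ℕ) * h := by gcongr; omega
  have hint (k : ℕ) (hk : k < n) :
      IntervalIntegrable g volume (k * h) ((k + 1 : ℕ) * h) := by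
    apply ContinuousOn.intervalIntegrable
    rw [Set.uIcc_of_le (hle k)]
    exact hg.mono (hsub k hk)
  have hsum := intervalIntegral.sum_integral_adjacent_intervals (a := fun k : ℕ => k * h) hint
  simp only [hnh, Nat.cast_zero, zero_mul] at hsum
  rw [← hsum, Finset.mul_sum, dist_eq_norm, ← Finset.sum_sub_distrib]
  have hterm (k : ℕ) (hk : k ∈ Finset.range n) :
      ‖h * g (k * h) - ∫ t in (k * h)..((k + 1 : ℕ) * h), g t‖ ≤ ε / (T + 1) * h := by
    rw [Finset.mem_range] at hk
    have e : h * g (k * h) = ∫ _ in (k * h)..((k + 1 : ℕ) * h), g (k * h) := by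
      rw [intervalIntegral.integral_const, smul_eq_mul]; push_cast; ring
    rw [e, ← intervalIntegral.integral_sub (by simp) (hint k hk)]
    have hb := intervalIntegral.norm_integral_le_of_norm_le_const (a := k * h)
      (b := (k + 1 : ℕ) * h) (f := fun t => g (k * h) - g t) (C := ε / (T + 1)) ?_
    · have e2 : |((k + 1 : ℕ) : ℝ) * h - k * h| = h := by
        rw [← sub_mul]; simp [abs_of_nonneg hh0]
      rwa [e2] at hb
    · intro t ht
      rw [Set.uIoc_of_le (hle k)] at ht
      refine (H _ (hsub k hk ⟨le_rfl, hle k⟩) _ (hsub k hk ⟨ht.1.le, ht.2⟩) ?_).le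
      rw [Real.dist_eq, abs_lt]
      have := ht.1
      have := ht.2
      push_cast at this
      constructor <;> linarith
  calc _ ≤ ∑ k ∈ Finset.range n, ε / (T + 1) * h := norm_sum_le_of_le _ hterm
    _ = ε * (T / (T + 1)) := by
      rw [Finset.sum_const, Finset.card_range, nsmul_eq_mul, ← hnh]; ring
    _ < ε := by
      have : T / (T + 1) < 1 := by rw [div_lt_one (by linarith)]; linarith
      nlinarith

/-- The Gaussian integral `E[exp (a (x + D)²)]` for `D` centered with variance `v`. -/
lemma lintegral_exp_sq_gaussianReal {v : ℝ≥0} (hv : v ≠ 0) {a : ℝ} (ha : 0 < 1 - 2 * a * v)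
    (x : ℝ) :
    ∫⁻ y, ENNReal.ofReal (exp (a * (x + y) ^ 2)) ∂gaussianReal 0 v =
      ENNReal.ofReal (√(1 - 2 * a * v))⁻¹ *
        ENNReal.ofReal (exp (a / (1 - 2 * a * v) * x ^ 2)) := by
  have hv0 : (0 : ℝ) < v := by exact_mod_cast pos_of_ne_zero hv
  set r := 1 - 2 * a * v with hr
  let w : ℝ≥0 := ⟨v / r, by positivity⟩
  have hw : w ≠ 0 := by
    have : (0 : ℝ) < v / r := by positivity
    exact fun h => this.ne' (congrArg NNReal.toReal h)
  have hwc : (w : ℝ) = v / r := rfl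
  rw [gaussianReal_of_var_ne_zero _ hv,
    lintegral_withDensity_eq_lintegral_mul _ (measurable_gaussianPDF _ _) (by fun_prop),
    ← ENNReal.ofReal_mul (by positivity)]
  calc _ = ∫⁻ y, ENNReal.ofReal ((√r)⁻¹ * exp (a / r * x ^ 2)) *
        gaussianPDF (2 * a * v * x / r) w y := by
        refine lintegral_congr fun y => ?_
        rw [Pi.mul_apply, gaussianPDF, gaussianPDF, ← ENNReal.ofReal_mul (by
          exact gaussianPDFReal_nonneg _ _ _), ← ENNReal.ofReal_mul (by positivity)]
        congr 1
        rw [gaussianPDFReal, gaussianPDFReal, hwc]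
        have e1 : √(2 * π * v) = √r * √(2 * π * (v / r)) := by
          rw [← Real.sqrt_mul ha.le]; congr 1; field_simp
        have hs : √r ≠ 0 := by positivity
        have hs' : √(2 * π * (v / r)) ≠ 0 := by positivity
        rw [e1, mul_assoc, ← Real.exp_add, mul_mul_mul_comm, ← Real.exp_add, mul_inv]
        congr 2
        field_simp
        rw [hr]
        ring
    _ = _ := by
        rw [lintegral_const_mul _ (measurable_gaussianPDF _ _), lintegral_gaussianPDF_eq_one _ hw,
          mul_one]

/-- Exponential moments pass to the limit when an exponential moment of higher order is bounded
along the sequence. -/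
lemma lintegral_exp_eq_of_tendsto {Ω : Type*} [MeasurableSpace Ω] {μ : Measure Ω}
    [IsFiniteMeasure μ] {X : ℕ → Ω → ℝ} {Y : Ω → ℝ} (hX : ∀ n, Measurable (X n))
    (hlim : ∀ᵐ ω ∂μ, Tendsto (fun n => X n ω) atTop (𝓝 (Y ω))) {c : ℝ} (hc : 1 < c)
    {A B : ℝ≥0∞} (hB : B ≠ ∞)
    (hA1 : Tendsto (fun n => ∫⁻ ω, ENNReal.ofReal (exp (X n ω)) ∂μ) atTop (𝓝 A))
    (hBc : Tendsto (fun n => ∫⁻ ω, ENNReal.ofReal (exp (c * X n ω)) ∂μ) atTop (𝓝 B)) :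
    ∫⁻ ω, ENNReal.ofReal (exp (Y ω)) ∂μ = A := by
  have hcont : Continuous fun x : ℝ => ENNReal.ofReal (exp x) :=
    ENNReal.continuous_ofReal.comp Real.continuous_exp
  apply le_antisymm
  · calc _ = ∫⁻ ω, liminf (fun n => ENNReal.ofReal (exp (X n ω))) atTop ∂μ := by
          refine lintegral_congr_ae ?_
          filter_upwards [hlim] with ω hω
          exact ((hcont.tendsto _).comp hω).liminf_eq.symm
      _ ≤ _ := lintegral_liminf_le fun n => by fun_prop
      _ = A := hA1.liminf_eq
  · have key (K : ℝ) : A ≤ (∫⁻ ω, ENNReal.ofReal (exp (Y ω)) ∂μ) +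
        ENNReal.ofReal (exp (-(c - 1) * K)) * B := by
      have hmin : Tendsto (fun n => ∫⁻ ω, ENNReal.ofReal (exp (min (X n ω) K)) ∂μ) atTop
          (𝓝 (∫⁻ ω, ENNReal.ofReal (exp (min (Y ω) K)) ∂μ)) := by
        refine tendsto_lintegral_of_dominated_convergence (fun _ => ENNReal.ofReal (exp K))
          (fun n => by fun_prop) (fun n => ?_) ?_ ?_
        · refine ae_of_all _ fun ω => ?_
          dsimp only
          gcongr
          exact min_le_right _ _
        · rw [lintegral_const]
          exact ENNReal.mul_ne_top (by simp) (measure_ne_top _ _)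
        · filter_upwards [hlim] with ω hω
          exact (hcont.tendsto _).comp (hω.min tendsto_const_nhds)
      have hle : A ≤ (∫⁻ ω, ENNReal.ofReal (exp (min (Y ω) K)) ∂μ) +
          ENNReal.ofReal (exp (-(c - 1) * K)) * B := by
        refine le_of_tendsto_of_tendsto' hA1
          (hmin.add (ENNReal.Tendsto.const_mul hBc (Or.inr (by simp)))) fun n => ?_
        rw [← lintegral_const_mul _ (by fun_prop), ← lintegral_add_left (by fun_prop)]
        refine lintegral_mono fun ω => ?_
        rw [← ENNReal.ofReal_mul (by positivity), ← ENNReal.ofReal_add (by positivity)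
          (by positivity), ← Real.exp_add]
        apply ENNReal.ofReal_le_ofReal
        rcases le_total (X n ω) K with h | h
        · rw [min_eq_left h]
          exact le_add_of_nonneg_right (by positivity)
        · refine le_add_of_nonneg_of_le (by positivity) ?_
          gcongr
          nlinarith
      refine hle.trans ?_
      gcongr
      exact min_le_left _ _
    have hK : Tendsto (fun K : ℝ => (∫⁻ ω, ENNReal.ofReal (exp (Y ω)) ∂μ) +
        ENNReal.ofReal (exp (-(c - 1) * K)) * B) atTop
        (𝓝 ((∫⁻ ω, ENNReal.ofReal (exp (Y ω)) ∂μ) + 0 * B)) := by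
      refine tendsto_const_nhds.add (ENNReal.Tendsto.mul_const ?_ (Or.inr hB))
      rw [← ENNReal.ofReal_zero]
      refine ENNReal.tendsto_ofReal (tendsto_exp_atBot.comp ?_)
      exact tendsto_id.const_mul_atTop_of_neg (by linarith)
    rw [zero_mul, add_zero] at hK
    exact ge_of_tendsto' hK key

/-- The exponential moment of a Riemann sum of the squared process plus a multiple of its squared
endpoint, when the coefficients are encoded by a positive solution of a linear recurrence. -/
lemma lintegral_exp_sum_sq {Ω : Type*} [MeasurableSpace Ω] {P : Measure Ω} {B : ℝ≥0 → Ω → ℝ}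
    (hB : IsPreBrownianReal B P) (hBm : ∀ t, Measurable (B t)) {h : ℝ≥0} (hh : h ≠ 0) {c : ℝ}
    {d : ℕ → ℝ} (hd : ∀ k, d (k + 2) = (2 - 2 * c * h ^ 2) * d (k + 1) - d k) (n : ℕ) :
    ∀ m, (∀ k ≤ m + n, 0 < d k) →
      ∫⁻ ω, ENNReal.ofReal (exp (c * (h * ∑ k ∈ Finset.range n, B (k * h) ω ^ 2) +
        (1 - d (m + 1) / d m) / (2 * h) * B (n * h) ω ^ 2)) ∂P =
      ENNReal.ofReal √(d m / d (m + n)) := by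
  have hP : IsProbabilityMeasure P := hB.isGaussianProcess.isProbabilityMeasure
  have hh0 : (0 : ℝ) < h := by exact_mod_cast pos_of_ne_zero hh
  induction n with
  | zero =>
    intro m hpos
    have h1 : ∫⁻ _, 1 ∂P = 1 := by simp
    rw [add_zero, div_self (hpos m (by simp)).ne', Real.sqrt_one, ENNReal.ofReal_one, ← h1]
    refine lintegral_congr_ae ?_
    filter_upwards [hB.eval_zero_ae_eq_zero] with ω hω
    simp [hω]
  | succ n ih =>
    intro m hpos
    have h0 : 0 < d m := hpos m (by omega)
    have h1 : 0 < d (m + 1) := hpos (m + 1) (by omega)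
    set a : ℝ := (1 - d (m + 1) / d m) / (2 * h) with ha
    have hq : 1 - 2 * a * h = d (m + 1) / d m := by rw [ha]; field_simp; ring
    have hq0 : 0 < 1 - 2 * a * h := by rw [hq]; positivity
    let t₀ : ℝ≥0 := n * h
    let D : Ω → ℝ := fun ω => B (t₀ + h) ω - B t₀ ω
    let Z : Ω → ℝ × ℝ := fun ω => (∑ k ∈ Finset.range (n + 1), B (k * h) ω ^ 2, B t₀ ω)
    have hDm : Measurable D := (hBm _).sub (hBm _)
    have hZm : Measurable Z :=
      (Finset.measurable_fun_sum _ fun k _ => (hBm _).pow_const 2).prodMk (hBm _)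
    have hlaw : Measure.map D P = gaussianReal 0 h := ((hB.shift t₀).hasLaw_eval h).map_eq
    have hind : IndepFun Z D P := by
      have hmem (k : Fin (n + 1)) : (k : ℝ≥0) * h ∈ Set.Iic t₀ := by
        simp only [t₀, Set.mem_Iic]
        gcongr
        exact_mod_cast Nat.lt_succ_iff.1 k.2
      let ψ : (Set.Iic t₀ → ℝ) → ℝ × ℝ := fun p =>
        (∑ k : Fin (n + 1), p ⟨(k : ℝ≥0) * h, hmem k⟩ ^ 2, p ⟨t₀, Set.self_mem_Iic⟩)
      have hφ : Measurable fun f : ℝ≥0 → ℝ => f h := measurable_pi_apply h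
      have hi := (hB.indepFun_shift t₀).comp (ψ := ψ) hφ (by fun_prop)
      have e : Z = ψ ∘ fun ω t => B t ω := by
        ext ω
        · simp [Z, ψ, Finset.sum_range]
        · rfl
      rw [e]
      exact hi.symm
    have hmap := (indepFun_iff_map_prod_eq_prod_map_map hZm.aemeasurable hDm.aemeasurable).1 hind
    have hend : ((n + 1 : ℕ) : ℝ≥0) * h = t₀ + h := by simp only [t₀]; push_cast; ring
    let F : (ℝ × ℝ) × ℝ → ℝ≥0∞ := fun p =>
      ENNReal.ofReal (exp (c * (h * p.1.1))) * ENNReal.ofReal (exp (a * (p.1.2 + p.2) ^ 2))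
    have hF : Measurable F := by fun_prop
    calc _ = ∫⁻ ω, F (Z ω, D ω) ∂P := by
          refine lintegral_congr fun ω => ?_
          simp only [F, Z, D]
          rw [← ENNReal.ofReal_mul (by positivity), ← Real.exp_add, hend, add_sub_cancel]
      _ = ∫⁻ ω, ENNReal.ofReal (exp (c * (h * (Z ω).1))) *
          (ENNReal.ofReal (√(1 - 2 * a * h))⁻¹ *
            ENNReal.ofReal (exp (a / (1 - 2 * a * h) * (Z ω).2 ^ 2))) ∂P := by
          rw [← lintegral_map hF (hZm.prodMk hDm), hmap, lintegral_prod _ hF.aemeasurable,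
            lintegral_map hF.lintegral_prod_right' hZm]
          refine lintegral_congr fun ω => ?_
          simp only [F]
          rw [hlaw, lintegral_const_mul _ (by fun_prop), lintegral_exp_sq_gaussianReal hh hq0]
      _ = ∫⁻ ω, ENNReal.ofReal (√(1 - 2 * a * h))⁻¹ *
          ENNReal.ofReal (exp (c * (h * ∑ k ∈ Finset.range n, B (k * h) ω ^ 2) +
            (1 - d (m + 1 + 1) / d (m + 1)) / (2 * h) * B (n * h) ω ^ 2)) ∂P := by
          refine lintegral_congr fun ω => ?_
          rw [mul_left_comm, ← ENNReal.ofReal_mul (by positivity), ← Real.exp_add]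
          congr 3
          simp only [Z, Finset.sum_range_succ, t₀]
          rw [hq, ha, hd]
          generalize ∑ k ∈ Finset.range n, B (k * h) ω ^ 2 = S
          field_simp
          ring
      _ = _ := by
          rw [lintegral_const_mul _ (by
              have := fun t => hBm t
              fun_prop), ih (m + 1) fun k hk => hpos k (by omega),
            ← ENNReal.ofReal_mul (by positivity), hq, ← Real.sqrt_inv,
            ← Real.sqrt_mul (by positivity)]
          have : 0 < d (m + (n + 1)) := hpos _ le_rfl
          rw [show m + 1 + n = m + (n + 1) by omega]
          congr 2
          field_simp

lemma tendsto_mul_arcsin_div (b : ℝ) :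
    Tendsto (fun n : ℕ => n * arcsin (b / n)) atTop (𝓝 b) := by
  have h0 : HasDerivAt (fun t : ℝ => arcsin (b * t)) b 0 := by
    have := HasDerivAt.comp (h₂ := arcsin) (h := fun t : ℝ => b * t) 0
      (Real.hasDerivAt_arcsin (by simp) (by simp)) ((hasDerivAt_id (0 : ℝ)).const_mul b)
    simpa [Function.comp_def] using this
  have h1 := h0.tendsto_slope_zero_right.comp tendsto_inv_atTop_nhdsGT_zero
    |>.comp tendsto_natCast_atTop_atTop
  refine h1.congr fun n => ?_
  simp [div_eq_mul_inv]

/-- The exponential moments of the left Riemann sums of `c * ∫ t in 0..T, B t ^ 2` converge to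
`1 / √(cos (√(2 * c) * T))`. -/
lemma tendsto_lintegral_exp_riemannSum {Ω : Type*} [MeasurableSpace Ω] {P : Measure Ω}
    {B : ℝ≥0 → Ω → ℝ} (hB : IsPreBrownianReal B P) (hBm : ∀ t, Measurable (B t)) {T : ℝ≥0}
    (hT : T ≠ 0) {c : ℝ} (hc : 0 ≤ c) (hcT : √(2 * c) * T < π / 2) :
    Tendsto (fun n : ℕ => ∫⁻ ω, ENNReal.ofReal
      (exp (c * (T / n * ∑ k ∈ Finset.range n, B (k * (T / n)) ω ^ 2))) ∂P) atTop
      (𝓝 (ENNReal.ofReal (1 / √(cos (√(2 * c) * T))))) := by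
  set b := √(c / 2) * T with hb
  have hb0 : 0 ≤ b := by positivity
  have hb2 : 2 * b = √(2 * c) * T := by
    rw [hb, show 2 * c = 2 ^ 2 * (c / 2) by ring, Real.sqrt_mul (by positivity),
      Real.sqrt_sq (by positivity)]
    ring
  rw [← hb2] at hcT ⊢
  let θ : ℕ → ℝ := fun n => 2 * arcsin (b / n)
  have hnθ : Tendsto (fun n : ℕ => n * θ n) atTop (𝓝 (2 * b)) := by
    refine ((tendsto_mul_arcsin_div b).const_mul 2).congr fun n => ?_
    simp only [θ]; ring
  have hbn : Tendsto (fun n : ℕ => b / n) atTop (𝓝 0) := tendsto_const_div_atTop_nhds_zero_nat b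
  have hθ : Tendsto θ atTop (𝓝 0) := by
    simpa using ((continuous_arcsin.tendsto 0).comp hbn).const_mul 2
  have hlim : Tendsto (fun n : ℕ => ENNReal.ofReal
      √(cos ((0 - 1 / 2) * θ n) / cos (n * θ n - 1 / 2 * θ n))) atTop
      (𝓝 (ENNReal.ofReal (1 / √(cos (2 * b))))) := by
    refine ENNReal.tendsto_ofReal ?_
    rw [← Real.sqrt_one, ← Real.sqrt_div zero_le_one, Real.sqrt_one]
    refine (Real.continuous_sqrt.tendsto _).comp (Tendsto.div ?_ ?_ ?_)
    · have h := (Real.continuous_cos.tendsto _).comp (hθ.const_mul (0 - 1 / 2))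
      rwa [mul_zero, Real.cos_zero] at h
    · have h := (Real.continuous_cos.tendsto _).comp (hnθ.sub (hθ.const_mul (1 / 2)))
      rwa [mul_zero, sub_zero] at h
    · exact (Real.cos_pos_of_mem_Ioo ⟨by linarith [Real.pi_pos], hcT⟩).ne'
  refine hlim.congr' ?_
  filter_upwards [hnθ.eventually (gt_mem_nhds hcT), hbn.eventually (gt_mem_nhds one_pos),
    eventually_gt_atTop 0] with n hn hbn1 hn0
  have hn1 : (1 : ℝ) ≤ n := by exact_mod_cast hn0
  have hbn0 : 0 ≤ b / n := by positivity
  have hθ0 : 0 ≤ θ n := mul_nonneg zero_le_two (arcsin_nonneg.2 hbn0)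
  let d : ℕ → ℝ := fun k => cos ((k - 1 / 2) * θ n)
  have hcosθ : cos (θ n) = 1 - c * ((T / n : ℝ≥0) : ℝ) ^ 2 := by
    simp only [θ]
    rw [Real.cos_two_mul, Real.cos_sq', Real.sin_arcsin (by linarith) hbn1.le, hb]
    push_cast
    rw [div_pow, mul_pow, Real.sq_sqrt (by positivity)]
    ring
  have hd (k : ℕ) : d (k + 2) = (2 - 2 * c * ((T / n : ℝ≥0) : ℝ) ^ 2) * d (k + 1) - d k := by
    have e1 : (((k + 2 : ℕ) : ℝ) - 1 / 2) * θ n = (((k + 1 : ℕ) : ℝ) - 1 / 2) * θ n + θ n := by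
      push_cast; ring
    have e2 : ((k : ℝ) - 1 / 2) * θ n = (((k + 1 : ℕ) : ℝ) - 1 / 2) * θ n - θ n := by
      push_cast; ring
    have e3 : 2 - 2 * c * ((T / n : ℝ≥0) : ℝ) ^ 2 = 2 * cos (θ n) := by rw [hcosθ]; ring
    simp only [d]
    rw [e1, e2, e3, Real.cos_add, Real.cos_sub]
    ring
  have hpos (k : ℕ) (hk : k ≤ 0 + n) : 0 < d k := by
    have hk' : (k : ℝ) ≤ n := by exact_mod_cast (by omega : k ≤ n)
    have hk0 : (0 : ℝ) ≤ k := k.cast_nonneg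
    refine Real.cos_pos_of_mem_Ioo ⟨?_, ?_⟩ <;> nlinarith
  have hmain := lintegral_exp_sum_sq hB hBm (h := T / n)
    (div_ne_zero hT (by exact_mod_cast hn0.ne')) hd n 0 hpos
  have hd1 : d (0 + 1) = d 0 := by
    simp only [d]
    rw [← Real.cos_neg]
    congr 1
    push_cast
    ring
  rw [hd1, div_self (hpos 0 (by simp)).ne'] at hmain
  simp only [sub_self, zero_div, zero_mul, add_zero, NNReal.coe_div, NNReal.coe_natCast] at hmain
  rw [hmain]
  simp only [d]
  rw [zero_add, sub_mul, Nat.cast_zero]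
  ring_nf

end

theorem exp_integral_brownian_sq {Ω : Type*} [MeasureSpace Ω]
    [IsProbabilityMeasure (ℙ : Measure Ω)] (W : ℝ → Ω → ℝ)
    (hW : IsStandardBrownianMotion W) (T : ℝ) (hT0 : 0 ≤ T)
    (hT : T < π / (2 * Real.sqrt 2)) :
    Integrable (fun ω => Real.exp (∫ t in (0 : ℝ)..T, (W t ω) ^ 2)) (ℙ : Measure Ω) ∧
    ∫ ω, Real.exp (∫ t in (0 : ℝ)..T, (W t ω) ^ 2) ∂(ℙ : Measure Ω)
      = 1 / Real.sqrt (Real.cos (Real.sqrt 2 * T)) := by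
  rcases hT0.eq_or_lt with rfl | hTpos
  · simp
  have hB := hW.isPreBrownianReal
  lift T to NNReal using hT0
  have hTne : T ≠ 0 := by rintro rfl; simp at hTpos
  have hT' : √2 * T < π / 2 := by
    rw [lt_div_iff₀ (by positivity)] at hT
    linarith
  have hcpos : 0 < Real.cos (√2 * T) :=
    Real.cos_pos_of_mem_Ioo ⟨by linarith [Real.pi_pos, show 0 ≤ √2 * (T : ℝ) by positivity], hT'⟩
  obtain ⟨c, hc, hcT⟩ : ∃ c : ℝ, 1 < c ∧ √(2 * c) * T < π / 2 := by
    have hcont : Continuous fun c : ℝ => √(2 * c) * T := by fun_prop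
    have hev := hcont.continuousAt.eventually_lt (x₀ := 1) continuousAt_const (by simpa using hT')
    exact ((hev.filter_mono nhdsWithin_le_nhds).and
      (self_mem_nhdsWithin (s := Set.Ioi (1 : ℝ)))).exists.imp fun c h => ⟨h.2, h.1⟩
  let X : ℕ → Ω → ℝ := fun n ω => T / n * ∑ k ∈ Finset.range n, W (k * (T / n)) ω ^ 2
  have hXm (n : ℕ) : Measurable (X n) :=
    (Finset.measurable_fun_sum _ fun k _ => (hW.measurable_eval _).pow_const 2).const_mul _
  have hlim : ∀ᵐ ω, Filter.Tendsto (fun n => X n ω) Filter.atTop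
      (nhds (∫ t in (0 : ℝ)..T, W t ω ^ 2)) := by
    filter_upwards [hW.ae_continuous] with ω hω
    exact tendsto_leftRiemannSum T.2 ((hω.mono Set.Icc_subset_Ici_self).pow 2)
  have hmom {b : ℝ} (hb : 0 ≤ b) (hbT : √(2 * b) * T < π / 2) :
      Filter.Tendsto (fun n => ∫⁻ ω, ENNReal.ofReal (Real.exp (b * X n ω))) Filter.atTop
        (nhds (ENNReal.ofReal (1 / √(Real.cos (√(2 * b) * T))))) := by
    refine (tendsto_lintegral_exp_riemannSum hB (fun t => hW.measurable_eval t) hTne hb hbT).congr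
      fun n => ?_
    simp [X]
  have hmom1 := hmom zero_le_one (by simpa using hT')
  simp only [one_mul, mul_one] at hmom1
  have hval := lintegral_exp_eq_of_tendsto hXm hlim hc ENNReal.ofReal_ne_top hmom1
    (hmom (by linarith) hcT)
  have hmeas : AEStronglyMeasurable (fun ω => Real.exp (∫ t in (0 : ℝ)..T, W t ω ^ 2))
      (ℙ : Measure Ω) :=
    (Real.measurable_exp.comp_aemeasurable (aemeasurable_of_tendsto_metrizable_ae Filter.atTop
      (fun n => (hXm n).aemeasurable) hlim)).aestronglyMeasurable
  have hnonneg : 0 ≤ᵐ[(ℙ : Measure Ω)] fun ω => Real.exp (∫ t in (0 : ℝ)..T, W t ω ^ 2) :=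
    ae_of_all _ fun ω => (Real.exp_pos _).le
  constructor
  · rw [← lintegral_ofReal_ne_top_iff_integrable hmeas hnonneg, hval]
    exact ENNReal.ofReal_ne_top
  · rw [integral_eq_lintegral_of_nonneg_ae hnonneg hmeas, hval, ENNReal.toReal_ofReal]
    positivity
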